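/- Let f, g be entire functions and φ, ψ : ℂ → ℂ homeomorphisms with ψ ∘ f = g ∘ φ. Suppose there are constants C ≥ 1, K ≥ 1 and R > 0 such that |z|^{1/K}/C ≤ |φ(z)| ≤ C|z|^K and |z|^{1/K}/C ≤ |ψ(z)| ≤ C|z|^K for all |z| ≥ R. If 0 < ρ(f) < ∞, then 0 < ρ(g) < ∞ and ρ(f)/K ≤ ρ(g) ≤ K·ρ(f). -/

import Mathlib

open Complex Set Filter Topology Metric MeasureTheory
open scoped ENNReal Real

noncomputable def logPlus (x : ℝ) : ℝ := max 0 (Real.log x)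

noncomputable def entireOrder (f : ℂ → ℂ) : ℝ≥0∞ :=
  Filter.limsup
    (fun z : ℂ => ENNReal.ofReal (logPlus (logPlus ‖f z‖) / Real.log ‖z‖))
    (Filter.comap (fun z : ℂ => ‖z‖) Filter.atTop)

def IsRegularValue (f : ℂ → ℂ) (w : ℂ) : Prop :=
  ∃ U : Set ℂ, IsOpen U ∧ w ∈ U ∧
    ∀ z ∈ f ⁻¹' U,
      ∃ e : ↥(connectedComponentIn (f ⁻¹' U) z) ≃ₜ ↥U,
        ∀ x : ↥(connectedComponentIn (f ⁻¹' U) z), (e x : ℂ) = f ↑x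

def singularSet (f : ℂ → ℂ) : Set ℂ := {w : ℂ | ¬ IsRegularValue f w}

def TranscendentalEntire (f : ℂ → ℂ) : Prop :=
  Differentiable ℂ f ∧ ¬ ∃ p : Polynomial ℂ, ∀ z, f z = p.eval z

def TopEquiv (f g : ℂ → ℂ) : Prop :=
  ∃ φ ψ : ℂ ≃ₜ ℂ, ∀ z, ψ (f z) = g (φ z)

noncomputable def cylArea (A : Set ℂ) : ℝ≥0∞ :=
  ∫⁻ z in A, ENNReal.ofReal (1 / ‖z‖ ^ 2)

def AreaProperty (f : ℂ → ℂ) : Prop :=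
  ∀ K : Set ℂ, IsCompact K → K ⊆ (singularSet f)ᶜ →
    cylArea (f ⁻¹' K \ Metric.ball (0 : ℂ) 1) < ⊤

theorem logPlus_nonneg (x : ℝ) : 0 ≤ logPlus x := le_max_left _ _

theorem logPlus_mono {x y : ℝ} (hx : 0 ≤ x) (hxy : x ≤ y) : logPlus x ≤ logPlus y :=
  Real.posLog_le_posLog hx hxy

theorem logPlus_mul_le (x y : ℝ) : logPlus (x * y) ≤ logPlus x + logPlus y :=
  Real.posLog_mul

theorem logPlus_max_one {x : ℝ} (hx : 0 ≤ x) : logPlus (max 1 x) = logPlus x := by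
  rcases le_total 1 x with h | h
  · rw [max_eq_right h]
  · rw [max_eq_left h]
    simp [logPlus, Real.log_nonpos hx h]

theorem logPlus_max_one_rpow {x K : ℝ} (hx : 0 ≤ x) (hK : 0 ≤ K) :
    logPlus (max 1 x ^ K) = K * logPlus x := by
  have h1 : (1 : ℝ) ≤ max 1 x := le_max_left _ _
  have h0 : 0 ≤ Real.log (max 1 x) := Real.log_nonneg h1
  rw [← logPlus_max_one hx, logPlus, Real.log_rpow (by linarith), logPlus, max_eq_right h0,
    max_eq_right (mul_nonneg hK h0)]

/-- A continuous map of at most power growth changes `log₊ log₊` of the modulus by at most an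
additive constant. -/
theorem exists_logPlus_logPlus_norm_le {ψ : ℂ → ℂ} (hψ : Continuous ψ) {D K R : ℝ} (hD : 0 ≤ D)
    (hK : 0 ≤ K) (hbound : ∀ z, R ≤ ‖z‖ → ‖ψ z‖ ≤ D * ‖z‖ ^ K) :
    ∃ M : ℝ, ∀ z, logPlus (logPlus ‖ψ z‖) ≤ logPlus (logPlus ‖z‖) + M := by
  obtain ⟨A, hA⟩ := (isCompact_closedBall (0 : ℂ) R).exists_bound_of_continuousOn hψ.continuousOn
  set B := max D A
  have hB : 0 ≤ B := hD.trans (le_max_left _ _)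
  have hpow (z : ℂ) : ‖ψ z‖ ≤ B * max 1 ‖z‖ ^ K := by
    have h1 : (1 : ℝ) ≤ max 1 ‖z‖ ^ K := Real.one_le_rpow (le_max_left _ _) hK
    rcases le_total R ‖z‖ with h | h
    · refine (hbound z h).trans ?_
      gcongr
      · exact le_max_left _ _
      · exact le_max_right _ _
    · calc ‖ψ z‖ ≤ A := hA z (by simpa using h)
        _ ≤ B := le_max_right _ _
        _ ≤ B * max 1 ‖z‖ ^ K := le_mul_of_one_le_right hB h1
  refine ⟨logPlus (logPlus B + K), fun z => ?_⟩
  have hlog : logPlus ‖ψ z‖ ≤ logPlus B + K * logPlus ‖z‖ := by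
    rw [← logPlus_max_one_rpow (norm_nonneg z) hK]
    exact (logPlus_mono (norm_nonneg _) (hpow z)).trans (logPlus_mul_le _ _)
  have hB' := logPlus_nonneg B
  calc logPlus (logPlus ‖ψ z‖)
      ≤ logPlus (max 1 (logPlus ‖z‖) * (logPlus B + K)) := by
        refine logPlus_mono (logPlus_nonneg _) (hlog.trans ?_)
        nlinarith [mul_le_mul_of_nonneg_left (le_max_left 1 (logPlus ‖z‖)) hB',
          mul_le_mul_of_nonneg_left (le_max_right 1 (logPlus ‖z‖)) hK]
    _ ≤ logPlus (max 1 (logPlus ‖z‖)) + logPlus (logPlus B + K) := logPlus_mul_le _ _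
    _ = logPlus (logPlus ‖z‖) + logPlus (logPlus B + K) := by
        rw [logPlus_max_one (logPlus_nonneg _)]

theorem entireOrder_eq_limsup_homeomorph (g : ℂ → ℂ) (φ : ℂ ≃ₜ ℂ) :
    entireOrder g = limsup
      (fun z => ENNReal.ofReal (logPlus (logPlus ‖g (φ z)‖) / Real.log ‖φ z‖))
      (comap (fun z : ℂ => ‖z‖) atTop) := by
  have h : map φ (comap (fun z : ℂ => ‖z‖) atTop) = comap (fun z : ℂ => ‖z‖) atTop := by
    rw [comap_norm_atTop, Metric.cobounded_eq_cocompact]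
    refine le_antisymm φ.isClosedEmbedding.tendsto_cocompact ?_
    have hsymm := Filter.map_mono (m := φ) φ.symm.isClosedEmbedding.tendsto_cocompact
    rwa [Filter.map_map, φ.self_comp_symm, Filter.map_id] at hsymm
  rw [entireOrder]
  conv_lhs => rw [← h]
  rfl

theorem entireOrder_le_mul_of_growth {f g : ℂ → ℂ} (φ ψ : ℂ ≃ₜ ℂ)
    (hequiv : ∀ z, ψ (f z) = g (φ z)) {D K R S : ℝ} (hD : 0 < D) (hK : 0 < K)
    (hφ : ∀ z, R ≤ ‖z‖ → ‖z‖ ≤ D * ‖φ z‖ ^ K)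
    (hψ : ∀ z, S ≤ ‖z‖ → ‖ψ z‖ ≤ D * ‖z‖ ^ K) :
    entireOrder g ≤ ENNReal.ofReal K * entireOrder f := by
  obtain ⟨M, hM⟩ := exists_logPlus_logPlus_norm_le ψ.continuous hD.le hK.le hψ
  have hK0 : ENNReal.ofReal K ≠ 0 := by simpa using hK
  rw [mul_comm, ← ENNReal.div_le_iff hK0 ENNReal.ofReal_ne_top]
  refine le_of_forall_gt_imp_ge_of_dense fun e he => ?_
  obtain ⟨b, hfb, hbe⟩ := ENNReal.lt_iff_exists_nnreal_btwn.1 he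
  obtain ⟨a, hfa, hab⟩ := ENNReal.lt_iff_exists_nnreal_btwn.1 hfb
  have hab' : (a : ℝ) < b := by exact_mod_cast hab
  refine le_trans ?_ hbe.le
  rw [ENNReal.div_le_iff hK0 ENNReal.ofReal_ne_top, entireOrder_eq_limsup_homeomorph g φ]
  refine limsup_le_of_le (by isBoundedDefault) ?_
  have hnorm : Tendsto (fun z : ℂ => ‖z‖) (comap (fun z : ℂ => ‖z‖) atTop) atTop :=
    tendsto_comap
  have hlog := Real.tendsto_log_atTop.comp hnorm
  filter_upwards [eventually_lt_of_limsup_lt hfa, hnorm.eventually_ge_atTop R,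
    hnorm.eventually_gt_atTop 0, hlog.eventually_gt_atTop 0,
    hlog.eventually_gt_atTop (Real.log D),
    hlog.eventually_ge_atTop ((M + b * Real.log D) / (b - a))] with z hz hzR hz0 hl0 hlD hlM
  simp only [Function.comp_apply] at hl0 hlD hlM
  have hfz : logPlus (logPlus ‖f z‖) ≤ a * Real.log ‖z‖ := by
    rw [← div_le_iff₀ hl0]
    rw [← ENNReal.ofReal_coe_nnreal] at hz
    exact (ENNReal.ofReal_le_ofReal_iff a.coe_nonneg).1 hz.le
  have hφ0 : 0 < ‖φ z‖ := by
    refine (norm_nonneg _).lt_of_ne' fun h => ?_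
    have := hφ z hzR
    rw [h, Real.zero_rpow hK.ne', mul_zero] at this
    exact absurd this hz0.not_ge
  have hlφ : Real.log ‖z‖ ≤ Real.log D + K * Real.log ‖φ z‖ := by
    rw [← Real.log_rpow hφ0, ← Real.log_mul hD.ne' (Real.rpow_pos_of_pos hφ0 K).ne']
    exact Real.log_le_log hz0 (hφ z hzR)
  have hlφ0 : 0 < Real.log ‖φ z‖ := by
    by_contra! h
    nlinarith
  rw [← ENNReal.ofReal_coe_nnreal, ← ENNReal.ofReal_mul b.coe_nonneg]
  refine ENNReal.ofReal_le_ofReal ?_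
  rw [div_le_iff₀ hlφ0, ← hequiv]
  rw [div_le_iff₀ (sub_pos.2 hab')] at hlM
  nlinarith [hM (f z), mul_le_mul_of_nonneg_left hlφ b.coe_nonneg]

theorem order_under_qc_equivalence (f g : ℂ → ℂ)
    (hf : Differentiable ℂ f) (hg : Differentiable ℂ g)
    (φ ψ : ℂ ≃ₜ ℂ) (hequiv : ∀ z : ℂ, ψ (f z) = g (φ z))
    (C K R : ℝ) (hC : 1 ≤ C) (hK : 1 ≤ K) (hR : 0 < R)
    (hφ : ∀ z : ℂ, R ≤ ‖z‖ → ‖z‖ ^ (1 / K) / C ≤ ‖φ z‖ ∧ ‖φ z‖ ≤ C * ‖z‖ ^ K)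
    (hψ : ∀ z : ℂ, R ≤ ‖z‖ → ‖z‖ ^ (1 / K) / C ≤ ‖ψ z‖ ∧ ‖ψ z‖ ≤ C * ‖z‖ ^ K)
    (hpos : 0 < entireOrder f) (hfin : entireOrder f < ⊤) :
    0 < entireOrder g ∧ entireOrder g < ⊤ ∧
      entireOrder f / ENNReal.ofReal K ≤ entireOrder g ∧
      entireOrder g ≤ ENNReal.ofReal K * entireOrder f := by
  have hC0 : 0 < C := by linarith
  have hK0 : 0 < K := by linarith
  have hCD : C ≤ C ^ K := Real.self_le_rpow_of_one_le hC hK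
  have hD0 : 0 < C ^ K := by linarith
  have hinv {x y : ℝ} (hx : 0 ≤ x) (hy : 0 ≤ y) (h : x ^ (1 / K) / C ≤ y) :
      x ≤ C ^ K * y ^ K := by
    rw [← Real.mul_rpow hC0.le hy, ← Real.rpow_inv_le_iff_of_pos hx (by positivity) hK0,
      ← one_div, mul_comm]
    exact (div_le_iff₀ hC0).1 h
  have hup {x y : ℝ} (hx : 0 ≤ x) (h : y ≤ C * x ^ K) : y ≤ C ^ K * x ^ K :=
    h.trans (mul_le_mul_of_nonneg_right hCD (Real.rpow_nonneg hx K))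
  have hsymm (χ : ℂ ≃ₜ ℂ) : ∃ S : ℝ, ∀ w, S ≤ ‖w‖ → R ≤ ‖χ.symm w‖ := by
    obtain ⟨A, hA⟩ := (isCompact_closedBall (0 : ℂ) R).exists_bound_of_continuousOn
      χ.continuous.continuousOn
    refine ⟨A + 1, fun w hw => ?_⟩
    by_contra! h
    have := hA (χ.symm w) (by simpa using h.le)
    rw [χ.apply_symm_apply] at this
    linarith
  obtain ⟨Sφ, hSφ⟩ := hsymm φ
  obtain ⟨Sψ, hSψ⟩ := hsymm ψ
  have hgf : entireOrder g ≤ ENNReal.ofReal K * entireOrder f :=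
    entireOrder_le_mul_of_growth φ ψ hequiv hD0 hK0
      (fun z hz => hinv (norm_nonneg _) (norm_nonneg _) (hφ z hz).1)
      (fun z hz => hup (norm_nonneg _) (hψ z hz).2)
  have hfg : entireOrder f ≤ ENNReal.ofReal K * entireOrder g :=
    entireOrder_le_mul_of_growth φ.symm ψ.symm
      (fun w => by rw [ψ.symm_apply_eq, hequiv, φ.apply_symm_apply]) hD0 hK0
      (fun w hw => hup (norm_nonneg _) (by simpa using (hφ _ (hSφ w hw)).2))
      (fun w hw => hinv (norm_nonneg _) (norm_nonneg _)
        (by simpa using (hψ _ (hSψ w hw)).1))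
  refine ⟨?_, hgf.trans_lt (ENNReal.mul_lt_top ENNReal.ofReal_lt_top hfin), ?_, hgf⟩
  · refine pos_of_ne_zero fun h => ?_
    rw [h, mul_zero] at hfg
    exact hpos.not_ge hfg
  · rw [mul_comm] at hfg
    exact ENNReal.div_le_of_le_mul hfg
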